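/- The moments of random correlations are invariant under local unitary transformations: for every 4×4 Hermitian matrix ρ, every pair of 2×2 unitary matrices V, W, and every positive integer t, ∬_{S²×S²} (Tr[(V⊗W) ρ (V⊗W)* (σ_u ⊗ σ_w)])^t dμ(u) dμ(w) = ∬_{S²×S²} (Tr[ρ (σ_u ⊗ σ_w)])^t dμ(u) dμ(w). -/

import Mathlib

open MeasureTheory Matrix Kronecker

noncomputable section

abbrev E3 : Type := EuclideanSpace ℝ (Fin 3)

/-- The unit sphere `S²` in `ℝ³`. -/
abbrev S2 : Type := Metric.sphere (0 : E3) 1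

/-- The action of a linear isometry (rotation) of `ℝ³` on the unit sphere. -/
def sphereMap (f : E3 ≃ₗᵢ[ℝ] E3) (x : S2) : S2 :=
  ⟨f x, by
    have h : ‖(x : E3)‖ = 1 := by simpa using mem_sphere_zero_iff_norm.mp x.2
    simp [mem_sphere_zero_iff_norm, h]⟩

/-- The three Pauli matrices `σ_x, σ_y, σ_z`. -/
def pauli : Fin 3 → Matrix (Fin 2) (Fin 2) ℂ
  | 0 => !![0, 1; 1, 0]
  | 1 => !![0, -Complex.I; Complex.I, 0]
  | 2 => !![1, 0; 0, -1]

/-- For a direction `u ∈ ℝ³`, the operator `σ_u = u₁σ₁ + u₂σ₂ + u₃σ₃`. -/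
def pauliVec (u : Fin 3 → ℝ) : Matrix (Fin 2) (Fin 2) ℂ :=
  ∑ j, (u j : ℂ) • pauli j

/-- The coordinates of a point of the unit sphere `S²`. -/
def coords (x : S2) : Fin 3 → ℝ := fun j => (x : E3) j

theorem pauliVec_eq (u : Fin 3 → ℝ) :
    pauliVec u = !![(u 2 : ℂ), u 0 - u 1 * Complex.I; u 0 + u 1 * Complex.I, -(u 2 : ℂ)] := by
  ext i j
  fin_cases i <;> fin_cases j <;>
    simp [pauliVec, pauli, Fin.sum_univ_three, sub_eq_add_neg]

theorem isHermitian_pauliVec (u : Fin 3 → ℝ) : (pauliVec u).IsHermitian := by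
  rw [pauliVec_eq]
  ext i j
  fin_cases i <;> fin_cases j <;> simp [sub_eq_add_neg]

theorem trace_pauliVec (u : Fin 3 → ℝ) : (pauliVec u).trace = 0 := by
  simp [pauliVec_eq, Matrix.trace_fin_two]

theorem det_pauliVec (u : E3) : (pauliVec u).det = -((‖u‖ ^ 2 : ℝ) : ℂ) := by
  rw [pauliVec_eq, Matrix.det_fin_two, EuclideanSpace.real_norm_sq_eq, Fin.sum_univ_three]
  simp only [Matrix.of_apply, Matrix.cons_val', Matrix.cons_val_zero, Matrix.cons_val_one,
    Matrix.cons_val_fin_one]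
  push_cast
  linear_combination (u 1 : ℂ) ^ 2 * Complex.I_sq

/-- The Bloch vector of a `2×2` matrix, inverse to `pauliVec` on traceless Hermitian matrices. -/
def blochVec (A : Matrix (Fin 2) (Fin 2) ℂ) : E3 :=
  !₂[(A 1 0).re, (A 1 0).im, (A 0 0).re]

theorem pauliVec_blochVec {A : Matrix (Fin 2) (Fin 2) ℂ} (hA : A.IsHermitian)
    (htr : A.trace = 0) : pauliVec (blochVec A) = A := by
  have h00 := hA.apply 0 0
  have h01 := hA.apply 0 1
  have h11 : A 1 1 = -A 0 0 := by
    rw [Matrix.trace_fin_two] at htr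
    linear_combination htr
  have him : (A 0 0).im = 0 := Complex.conj_eq_iff_im.mp h00
  rw [pauliVec_eq]
  ext i j
  fin_cases i <;> fin_cases j <;>
    simp [blochVec, h11, ← h01, Complex.ext_iff, him]

/-- Conjugation by a matrix, read as a linear map on Bloch vectors. -/
def blochConj (V : Matrix (Fin 2) (Fin 2) ℂ) : E3 →ₗ[ℝ] E3 where
  toFun u := blochVec (Vᴴ * pauliVec u * V)
  map_add' u v := by
    have h : pauliVec (u + v).ofLp = pauliVec u + pauliVec v := by
      simp [pauliVec, add_smul, Finset.sum_add_distrib]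
    rw [h, Matrix.mul_add, Matrix.add_mul]
    ext i
    fin_cases i <;> simp [blochVec]
  map_smul' c u := by
    have h : pauliVec (c • u).ofLp = (c : ℂ) • pauliVec u := by
      simp [pauliVec, Finset.smul_sum, mul_smul]
    rw [h, Matrix.mul_smul, Matrix.smul_mul]
    ext i
    fin_cases i <;> simp [blochVec]

theorem pauliVec_blochConj {V : Matrix (Fin 2) (Fin 2) ℂ}
    (hV : V ∈ Matrix.unitaryGroup (Fin 2) ℂ) (u : E3) :
    pauliVec (blochConj V u) = Vᴴ * pauliVec u * V := by
  refine pauliVec_blochVec (isHermitian_conjTranspose_mul_mul V (isHermitian_pauliVec u)) ?_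
  rw [Matrix.trace_mul_cycle, ← Matrix.star_eq_conjTranspose, Matrix.mem_unitaryGroup_iff.mp hV,
    Matrix.one_mul, trace_pauliVec]

theorem norm_blochConj {V : Matrix (Fin 2) (Fin 2) ℂ}
    (hV : V ∈ Matrix.unitaryGroup (Fin 2) ℂ) (u : E3) : ‖blochConj V u‖ = ‖u‖ := by
  have hdet : (Vᴴ).det * V.det = 1 := by
    rw [← Matrix.det_mul, ← Matrix.star_eq_conjTranspose, Matrix.mem_unitaryGroup_iff'.mp hV,
      Matrix.det_one]
  have h := det_pauliVec (blochConj V u)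
  rw [pauliVec_blochConj hV, Matrix.det_mul, Matrix.det_mul, det_pauliVec] at h
  have hsq : ((‖blochConj V u‖ ^ 2 : ℝ) : ℂ) = ((‖u‖ ^ 2 : ℝ) : ℂ) := by
    linear_combination h + ((‖u‖ ^ 2 : ℝ) : ℂ) * hdet
  exact (sq_eq_sq₀ (norm_nonneg _) (norm_nonneg _)).mp (Complex.ofReal_injective hsq)

/-- A unitary matrix acts on Bloch vectors by a linear isometry. -/
theorem exists_isometry_pauliVec {V : Matrix (Fin 2) (Fin 2) ℂ}
    (hV : V ∈ Matrix.unitaryGroup (Fin 2) ℂ) :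
    ∃ f : E3 ≃ₗᵢ[ℝ] E3, ∀ x : S2,
      pauliVec (coords (sphereMap f x)) = Vᴴ * pauliVec (coords x) * V :=
  ⟨LinearIsometry.toLinearIsometryEquiv ⟨blochConj V, norm_blochConj hV⟩ rfl,
    fun x => pauliVec_blochConj hV x⟩

theorem continuous_sphereMap (f : E3 ≃ₗᵢ[ℝ] E3) : Continuous (sphereMap f) :=
  (f.continuous.comp continuous_subtype_val).subtype_mk _

theorem continuous_pauliVec_coords : Continuous fun x : S2 => pauliVec (coords x) := by
  unfold pauliVec coords
  fun_prop

theorem continuous_correlation (ρ : Matrix (Fin 2 × Fin 2) (Fin 2 × Fin 2) ℂ) :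
    Continuous fun p : S2 × S2 =>
      ((ρ * (pauliVec (coords p.1) ⊗ₖ pauliVec (coords p.2))).trace).re := by
  have h₁ := continuous_pauliVec_coords.comp (continuous_fst (X := S2) (Y := S2))
  have h₂ := continuous_pauliVec_coords.comp (continuous_snd (X := S2) (Y := S2))
  have h : Continuous fun p : S2 × S2 =>
      pauliVec (coords p.1) ⊗ₖ pauliVec (coords p.2) :=
    continuous_matrix fun i j => (h₁.matrix_elem i.1 j.1).mul (h₂.matrix_elem i.2 j.2)
  exact Complex.continuous_re.comp (continuous_const.matrix_mul h).matrix_trace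

theorem trace_kronecker_conj (ρ : Matrix (Fin 2 × Fin 2) (Fin 2 × Fin 2) ℂ)
    (V W A B : Matrix (Fin 2) (Fin 2) ℂ) :
    ((V ⊗ₖ W) * ρ * (V ⊗ₖ W)ᴴ * (A ⊗ₖ B)).trace =
      (ρ * ((Vᴴ * A * V) ⊗ₖ (Wᴴ * B * W))).trace := by
  rw [Matrix.mul_kronecker_mul, Matrix.mul_kronecker_mul, ← Matrix.conjTranspose_kronecker,
    Matrix.mul_assoc, Matrix.mul_assoc, Matrix.trace_mul_comm, Matrix.mul_assoc]

/-- the moments of random correlations are invariant under local unitary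
transformations: for every `4×4` Hermitian matrix `ρ`, all `2×2` unitaries `V, W` and every
positive integer `t`,
`∬ (Tr[(V⊗W) ρ (V⊗W)* (σ_u ⊗ σ_w)])^t dμ dμ = ∬ (Tr[ρ (σ_u ⊗ σ_w)])^t dμ dμ`,
where `μ` is the rotation-invariant (uniform) probability measure on `S²`. -/
theorem moments_local_unitary_invariant
    (ρ : Matrix (Fin 2 × Fin 2) (Fin 2 × Fin 2) ℂ) (hρ : ρ.IsHermitian)
    (V W : Matrix (Fin 2) (Fin 2) ℂ)
    (hV : V ∈ Matrix.unitaryGroup (Fin 2) ℂ) (hW : W ∈ Matrix.unitaryGroup (Fin 2) ℂ)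
    (t : ℕ) (ht : 0 < t)
    (μ : Measure S2) [IsProbabilityMeasure μ]
    (hinv : ∀ f : E3 ≃ₗᵢ[ℝ] E3, μ.map (sphereMap f) = μ) :
    (∫ p : S2 × S2,
        (((V ⊗ₖ W) * ρ * (V ⊗ₖ W)ᴴ *
          (pauliVec (coords p.1) ⊗ₖ pauliVec (coords p.2))).trace).re ^ t
        ∂(μ.prod μ)) =
    ∫ p : S2 × S2,
        ((ρ * (pauliVec (coords p.1) ⊗ₖ pauliVec (coords p.2))).trace).re ^ t
        ∂(μ.prod μ) := by
  obtain ⟨f, hf⟩ := exists_isometry_pauliVec hV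
  obtain ⟨g, hg⟩ := exists_isometry_pauliVec hW
  have hfμ : MeasurePreserving (sphereMap f) μ μ := ⟨(continuous_sphereMap f).measurable, hinv f⟩
  have hgμ : MeasurePreserving (sphereMap g) μ μ := ⟨(continuous_sphereMap g).measurable, hinv g⟩
  have hfg := hfμ.prod hgμ
  conv_rhs => rw [← hfg.map_eq]
  rw [integral_map hfg.aemeasurable (by
    exact ((continuous_correlation ρ).pow t).measurable.aestronglyMeasurable)]
  simp only [trace_kronecker_conj, Prod.map_fst, Prod.map_snd, hf, hg]
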